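/- In the prepare-and-measure scenario on ℂ² with n settings: suppose the target pure qubit states ρ^x_a (a∈{1,2}, x∈[n]) are such that for each x the pair (ρ^x_1, ρ^x_2) consists of rank-one orthogonal projections with ρ^x_1 + ρ^x_2 = I, and suppose the experimental density matrices ρ̃^x_a on ℂ² and experimental 2-outcome POVMs on ℂ² generate statistics ε-close to the target ones (|Re tr(ρ̃^x_a M̃^y_b) − Re tr(ρ^x_a ρ^y_b)| ≤ ε for all a,b,x,y), with 0 ≤ ε ≤ 1/3. Let ρ_1, …, ρ_m be a subset of m of the target states, let L be the m×3 real matrix whose i-th row is the Bloch vector of ρ_i (so ρ_i = (1/2)(I + n_i·σ) with Pauli matrices σ), and let k ∈ {2,3} be the rank of L; if k = 2 assume the third Bloch component of every ρ_i vanishes and truncate L to its first two columns, so that LᵀL is invertible. Let L^‡ = (LᵀL)⁻¹Lᵀ be the Moore–Penrose pseudoinverse of L, and define F_m(ε) = √(4m(m−1)ε(1 + 2√ε + ((m+3)/(m−1))ε)) and P_m(ε,L) = ‖L^‡‖F_m(ε) + min( ‖L^‡‖F_m(ε)/√(1 − ‖L^‡‖²F_m(ε)), √(√k·F_m(ε))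 ) if ‖L^‡‖√(F_m(ε)) < 1, and P_m(ε,L) = ‖L^‡‖F_m(ε) + √(√k·F_m(ε)) otherwise. Then there exists a 2×2 unitary U such that either (1/m)∑_{i=1}^m Re tr(ρ_i U ρ̃_i U*) ≥ 1 − ε(1−2ε)/(1−ε)² − P_m(ε,L)²/(4m), or the same inequality holds with each ρ̃_i replaced by its transpose (ρ̃_i)ᵀ in a fixed basis of ℂ², where ρ̃_i is the experimental counterpart of ρ_i. (Lemma 4: robust self-testing bound via the orthogonal Procrustes problem.) -/

import Mathlib

open Matrix
open scoped ComplexOrder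

/-- Operator (spectral) norm of a real matrix, as the norm of the induced
map between Euclidean spaces. -/
noncomputable def opNormR {m n : ℕ} (A : Matrix (Fin m) (Fin n) ℝ) : ℝ :=
  ‖LinearMap.toContinuousLinearMap (Matrix.toEuclideanLin A)‖

/-- A density matrix: positive semidefinite with trace one. -/
def IsDensityMatrix {d : ℕ} (ρ : Matrix (Fin d) (Fin d) ℂ) : Prop :=
  ρ.PosSemidef ∧ ρ.trace = 1

/-- A pure state: a rank-one orthogonal projection (Hermitian, idempotent, trace one). -/
def IsPureState {d : ℕ} (ρ : Matrix (Fin d) (Fin d) ℂ) : Prop :=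
  ρ.IsHermitian ∧ ρ * ρ = ρ ∧ ρ.trace = 1

/-- The Pauli matrices `σ_x, σ_y, σ_z`. -/
def pauli : Fin 3 → Matrix (Fin 2) (Fin 2) ℂ :=
  ![!![0, 1; 1, 0], !![0, -Complex.I; Complex.I, 0], !![1, 0; 0, -1]]

/-- The `j`-th component of the Bloch vector of a qubit state `ρ`,
i.e. `Re tr(ρ σ_j)`. -/
noncomputable def bloch (ρ : Matrix (Fin 2) (Fin 2) ℂ) (j : Fin 3) : ℝ :=
  ((ρ * pauli j).trace).re

/-- The function `F_m(ε)` of Lemma 4. -/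
noncomputable def Fm (m : ℕ) (ε : ℝ) : ℝ :=
  Real.sqrt (4 * (m : ℝ) * ((m : ℝ) - 1) * ε *
    (1 + 2 * Real.sqrt ε + (((m : ℝ) + 3) / ((m : ℝ) - 1)) * ε))

open Classical in
/-- The function `P_m(ε, L)` of Lemma 4, expressed in terms of `c = ‖L^‡‖`,
`F = F_m(ε)` and the rank `k` of `L`. -/
noncomputable def Pm (k : ℕ) (c F : ℝ) : ℝ :=
  if c * Real.sqrt F < 1 then
    c * F + min (c * F / Real.sqrt (1 - c^2 * F)) (Real.sqrt (Real.sqrt (k : ℝ) * F))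
  else
    c * F + Real.sqrt (Real.sqrt (k : ℝ) * F)

open scoped InnerProductSpace

theorem singular_value_lower_bound {s g q r η C : ℝ} (hs : 0 ≤ s) (hr : 0 ≤ r) (hr1 : r ≤ 1)
    (hη : 0 ≤ η) (hgq : g ^ 2 ≤ r * q) (hsq : q - η * g ≤ s ^ 2) (hrg : r ≤ C * g)
    (hg : 0 ≤ g) :
    g - r * η ≤ s ∧ g - r * (η / 2 * (1 + η * C)) ≤ s := by
  rcases hr.eq_or_lt with rfl | hr
  · have : g = 0 := by nlinarith
    subst this
    simpa using hs
  obtain ⟨x, rfl⟩ : ∃ x, g = r * x := ⟨g / r, by field_simp⟩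
  have hx : 0 ≤ x := nonneg_of_mul_nonneg_right hg hr
  have hCx : 1 ≤ C * x := by
    by_contra! h
    nlinarith
  have hq : r * x ^ 2 ≤ q := by
    by_contra! h
    nlinarith
  have key : r * (x ^ 2 - η * x) ≤ s ^ 2 := by linarith
  have hlow : ∀ l, 0 ≤ l → (l ≤ x → (x - l) ^ 2 ≤ x ^ 2 - η * x) → r * x - r * l ≤ s := by
    intro l hl h
    rcases le_total x l with h' | h'
    · nlinarith
    · refine abs_le_of_sq_le_sq' ?_ hs |>.2
      have h1 := h h'
      have h2 := mul_le_mul_of_nonneg_left h1 hr.le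
      have h3 : r * (r * (x - l) ^ 2) ≤ 1 * (r * (x - l) ^ 2) :=
        mul_le_mul_of_nonneg_right hr1 (by positivity)
      nlinarith
  have hx0 : 0 < x := by
    rcases hx.eq_or_lt with rfl | h
    · norm_num at hCx
    · exact h
  have hC : 0 < C := by
    by_contra! h
    nlinarith
  refine ⟨hlow η hη fun h => by nlinarith, hlow _ (by positivity) fun h => ?_⟩
  obtain ⟨d, hd⟩ : ∃ d, d = η ^ 2 * C := ⟨_, rfl⟩
  have hl : η / 2 * (1 + η * C) = (η + d) / 2 := by rw [hd]; ring
  rw [hl] at h ⊢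
  have hdx : η ^ 2 ≤ d * x := by
    have := mul_le_mul_of_nonneg_left hCx (sq_nonneg η)
    rw [hd]; linarith
  have hd0 : 0 ≤ d := by rw [hd]; positivity
  have hηx : η ≤ x := by
    by_contra! hlt
    have : η < d := by
      by_contra! h'
      nlinarith
    linarith
  nlinarith [mul_nonneg hd0 hη, mul_nonneg hd0 hd0, mul_nonneg hd0 (sub_nonneg.2 h), mul_nonneg hd0 (sub_nonneg.2 hηx)]

theorem procrustes_budget_small {k m C ε s : ℝ} (hk : k = 2 ∨ k = 3) (hkm : k ≤ m)
    (hC : k ≤ C * m) (hs : 0 ≤ s) (hs3 : s ^ 2 ≤ 1 / 3) (hε : ε = s ^ 2) :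
    4 * (k * ((3 * ε * m) / 2 * (1 + (3 * ε * m) * C))) ≤
      4 * (C * (4 * (m * (m - 1) * ε * (1 + s) ^ 2 + 4 * m * ε ^ 2))) := by
  subst hε
  have hm : 0 < m := by rcases hk with rfl | rfl <;> linarith
  have hC0 : 0 < C := by
    by_contra! h
    rcases hk with rfl | rfl <;> nlinarith
  have h1 : 6 * s ^ 2 * m * k ≤ 6 * s ^ 2 * m * (C * m) :=
    mul_le_mul_of_nonneg_left hC (by positivity)
  have hs1 : s ≤ 0.578 := by nlinarith
  have h2 : 3 * m + 9 * k * s ^ 2 * m ≤ 8 * (m - 1) * (1 + s) ^ 2 + 32 * s ^ 2 := by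
    rcases hk with rfl | rfl
    · nlinarith [mul_nonneg (sub_nonneg.2 hkm) hs, mul_nonneg (sub_nonneg.2 hkm) (sub_nonneg.2 hs3)]
    · have : 27 * s ^ 2 ≤ 7 / 3 + 32 / 3 * s + 16 / 3 * s ^ 2 := by nlinarith
      nlinarith [mul_nonneg (sub_nonneg.2 hkm) hs, mul_nonneg (sub_nonneg.2 hkm) (sub_nonneg.2 hs3)]
  have h3 := mul_le_mul_of_nonneg_left h2 (show 0 ≤ 2 * C * m * s ^ 2 by positivity)
  nlinarith

theorem procrustes_budget_large {k m C F r t ε s : ℝ}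
    (hk : k = 2 ∨ k = 3) (hkm : k ≤ m) (hC : k ≤ C * m) (hs : 0 ≤ s) (hs3 : s ^ 2 ≤ 1 / 3)
    (hε : ε = s ^ 2) (hF : 0 ≤ F)
    (hF2 : F ^ 2 = 4 * (m * (m - 1) * ε * (1 + s) ^ 2 + 4 * m * ε ^ 2))
    (ht : 0 ≤ t) (hr : 0 ≤ r) (hrk : r ^ 2 = k) (htr : t ^ 2 = r) :
    4 * (k * (3 * ε * m)) ≤ C * F ^ 2 + 2 * (t * F) + r * F := by
  subst hε
  have hm : 0 < m := by rcases hk with rfl | rfl <;> linarith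
  have hs1 : s ≤ 0.578 := by nlinarith
  have hCF : k * F ^ 2 ≤ m * (C * F ^ 2) := by nlinarith [sq_nonneg F]
  obtain ⟨f, rfl⟩ : ∃ f, F = m * f := ⟨F / m, by field_simp⟩
  have hf : 0 ≤ f := nonneg_of_mul_nonneg_right hF hm
  have hmf : 4 * ((m - 1) * (s * (1 + s)) ^ 2) ≤ m * f ^ 2 := by
    by_contra! h
    nlinarith [mul_lt_mul_of_pos_left h hm, mul_nonneg hm.le (sq_nonneg (s ^ 2))]
  have hCF' : m * (k * f ^ 2) ≤ C * (m * f) ^ 2 := by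
    by_contra! h
    nlinarith [mul_lt_mul_of_pos_left h hm]
  suffices h : 12 * k * s ^ 2 ≤ k * f ^ 2 + (2 * t + r) * f by
    have := mul_le_mul_of_nonneg_left h hm.le
    nlinarith
  rcases hk with rfl | rfl
  · have hr' : 1.414 ≤ r := by nlinarith
    have ht' : 1.189 ≤ t := by nlinarith
    have hfl : 1.414 * (s * (1 + s)) ≤ f := by
      refine abs_le_of_sq_le_sq' ?_ hf |>.2
      by_contra! h
      nlinarith [sq_nonneg (s * (1 + s)), mul_lt_mul_of_pos_left h hm,
        mul_nonneg (sub_nonneg.2 hkm) (sq_nonneg (s * (1 + s)))]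
    have h1 : 2 * (1.414 * (s * (1 + s))) ^ 2 ≤ 2 * f ^ 2 := by gcongr
    have h2 : 3.792 * (1.414 * (s * (1 + s))) ≤ (2 * t + r) * f := by
      gcongr; linarith
    have h3 : 24 * s ≤ 3.998 * s * (1 + s) ^ 2 + 5.36 * (1 + s) := by
      nlinarith [mul_nonneg hs (sub_nonneg.2 hs1), mul_nonneg (mul_nonneg hs hs) (sub_nonneg.2 hs1), sq_nonneg (s - 0.578)]
    linarith [mul_le_mul_of_nonneg_left h3 hs, sq_nonneg (s * (1 + s)), mul_nonneg hs hs]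
  · have hr' : 1.732 ≤ r := by nlinarith
    have ht' : 1.316 ≤ t := by nlinarith
    have hfl : 1.63 * (s * (1 + s)) ≤ f := by
      refine abs_le_of_sq_le_sq' ?_ hf |>.2
      by_contra! h
      nlinarith [sq_nonneg (s * (1 + s)), mul_lt_mul_of_pos_left h hm,
        mul_nonneg (sub_nonneg.2 hkm) (sq_nonneg (s * (1 + s)))]
    have h1 : 3 * (1.63 * (s * (1 + s))) ^ 2 ≤ 3 * f ^ 2 := by gcongr
    have h2 : 4.36 * (1.63 * (s * (1 + s))) ≤ (2 * t + r) * f := by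
      gcongr; linarith
    have h3 : 36 * s ≤ 7.97 * s * (1 + s) ^ 2 + 7.1 * (1 + s) := by
      nlinarith [mul_nonneg hs (sub_nonneg.2 hs1), mul_nonneg hs (sq_nonneg (s - 0.467)), sq_nonneg (s - 0.467)]
    linarith [mul_le_mul_of_nonneg_left h3 hs, sq_nonneg (s * (1 + s)), mul_nonneg hs hs]

theorem exists_orthonormalBasis_map_eq_norm_smul {ι E : Type*} [Fintype ι] [DecidableEq ι]
    [NormedAddCommGroup E] [InnerProductSpace ℝ E] [FiniteDimensional ℝ E]
    (hι : Module.finrank ℝ E = Fintype.card ι) (T : E →ₗ[ℝ] E) :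
    ∃ b f : OrthonormalBasis ι ℝ E, ∀ a, T (b a) = ‖T (b a)‖ • f a := by
  have hsymm := T.isSymmetric_adjoint_mul_self
  let b := (hsymm.eigenvectorBasis rfl).reindex
    (Fintype.equivOfCardEq (by simp [hι]) : Fin (Module.finrank ℝ E) ≃ ι)
  have horth : ∀ a a', a ≠ a' → ⟪T (b a), T (b a')⟫_ℝ = 0 := by
    intro a a' h
    rw [← LinearMap.adjoint_inner_right]
    have : (LinearMap.adjoint T) (T (b a')) = (LinearMap.adjoint T * T) (b a') := rfl
    rw [this, OrthonormalBasis.reindex_apply _ _ a', hsymm.apply_eigenvectorBasis,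
      ← OrthonormalBasis.reindex_apply, inner_smul_right, b.orthonormal.2 h, mul_zero]
  let s : Set ι := {a | T (b a) ≠ 0}
  have hs : Orthonormal ℝ (s.domRestrict fun a => ‖T (b a)‖⁻¹ • T (b a)) := by
    refine ⟨fun a => ?_, fun a a' h => ?_⟩
    · have : ‖T (b a)‖ ≠ 0 := norm_ne_zero_iff.2 a.2
      change ‖‖T (b a)‖⁻¹ • T (b a)‖ = 1
      rw [norm_smul, norm_inv, norm_norm, inv_mul_cancel₀ this]
    · change ⟪‖T (b a)‖⁻¹ • T (b a), ‖T (b a')‖⁻¹ • T (b a')⟫_ℝ = 0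
      rw [inner_smul_left, inner_smul_right, horth a a' (Subtype.coe_injective.ne h)]
      simp
  obtain ⟨f, hf⟩ := hs.exists_orthonormalBasis_extension_of_card_eq hι
  refine ⟨b, f, fun a => ?_⟩
  by_cases ha : T (b a) = 0
  · simp [ha]
  · rw [hf a ha, smul_smul, mul_inv_cancel₀ (norm_ne_zero_iff.2 ha), one_smul]

theorem exists_isometry_sum_inner_eq {ι κ E : Type*} [Fintype ι] [Fintype κ]
    [DecidableEq ι] [NormedAddCommGroup E] [InnerProductSpace ℝ E] [FiniteDimensional ℝ E]
    (hι : Module.finrank ℝ E = Fintype.card ι) (u v : κ → E) :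
    ∃ (O : E ≃ₗᵢ[ℝ] E) (b : OrthonormalBasis ι ℝ E),
      ∑ i, ⟪u i, O (v i)⟫_ℝ = ∑ a, ‖∑ i, ⟪u i, b a⟫_ℝ • v i‖ := by
  let T : E →ₗ[ℝ] E := ∑ i, (innerₛₗ ℝ (u i)).smulRight (v i)
  have hT : ∀ x, T x = ∑ i, ⟪u i, x⟫_ℝ • v i := fun x => by simp [T]
  obtain ⟨b, f, h⟩ := exists_orthonormalBasis_map_eq_norm_smul hι T
  refine ⟨f.equiv b (Equiv.refl ι), b, ?_⟩
  have hO : ∀ i, ⟪u i, f.equiv b (Equiv.refl ι) (v i)⟫_ℝ = ∑ a, ⟪u i, b a⟫_ℝ * ⟪f a, v i⟫_ℝ := by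
    intro i
    rw [← b.sum_inner_mul_inner]
    refine Finset.sum_congr rfl fun a _ => ?_
    congr 1
    have : b a = f.equiv b (Equiv.refl ι) (f a) := by simp
    rw [this, LinearIsometryEquiv.inner_map_map]
  simp_rw [hO]
  rw [Finset.sum_comm]
  refine Finset.sum_congr rfl fun a _ => ?_
  rw [← hT]
  have : ‖T (b a)‖ = ⟪f a, T (b a)⟫_ℝ := by
    conv_rhs => rw [h a]
    simp [inner_smul_right]
  rw [this, hT, inner_sum]
  simp [inner_smul_right]

theorem inner_sum_smul_lower_bound {κ E : Type*} [Fintype κ] [NormedAddCommGroup E]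
    [InnerProductSpace ℝ E] {n y w : κ → E} {δ : ℝ} (hδ : 0 ≤ δ)
    (h : ∀ i j, |⟪y i, w j⟫_ℝ - ⟪n i, n j⟫_ℝ| ≤ δ) (u : κ → ℝ) :
    ‖∑ i, u i • n i‖ ^ 2 - δ * Fintype.card κ * ∑ i, u i ^ 2 ≤
      ⟪∑ i, u i • y i, ∑ j, u j • w j⟫_ℝ := by
  have hexp : ∀ p q : κ → E, ⟪∑ i, u i • p i, ∑ j, u j • q j⟫_ℝ =
      ∑ i, ∑ j, u i * u j * ⟪p i, q j⟫_ℝ := by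
    intro p q
    rw [sum_inner]
    refine Finset.sum_congr rfl fun i _ => ?_
    rw [inner_sum]
    refine Finset.sum_congr rfl fun j _ => ?_
    rw [real_inner_smul_left, real_inner_smul_right, mul_assoc]
  have habs : (∑ i, |u i|) ^ 2 ≤ Fintype.card κ * ∑ i, u i ^ 2 := by
    simpa using sq_sum_le_card_mul_sum_sq (s := Finset.univ) (f := fun i => |u i|)
  have hdiff : ∑ i, ∑ j, u i * u j * ⟪n i, n j⟫_ℝ - ∑ i, ∑ j, u i * u j * ⟪y i, w j⟫_ℝ ≤
      δ * (∑ i, |u i|) ^ 2 := by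
    rw [sq, Finset.sum_mul_sum, Finset.mul_sum, ← Finset.sum_sub_distrib]
    refine Finset.sum_le_sum fun i _ => ?_
    rw [Finset.mul_sum, ← Finset.sum_sub_distrib]
    refine Finset.sum_le_sum fun j _ => ?_
    calc _ = -(u i * u j * (⟪y i, w j⟫_ℝ - ⟪n i, n j⟫_ℝ)) := by ring
      _ ≤ |u i * u j * (⟪y i, w j⟫_ℝ - ⟪n i, n j⟫_ℝ)| := neg_le_abs _
      _ = |u i| * |u j| * |⟪y i, w j⟫_ℝ - ⟪n i, n j⟫_ℝ| := by rw [abs_mul, abs_mul]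
      _ ≤ |u i| * |u j| * δ := by gcongr; exact h i j
      _ = _ := by ring
  rw [← real_inner_self_eq_norm_sq, hexp, hexp]
  have := mul_le_mul_of_nonneg_left habs hδ
  linarith

theorem inner_le_norm_midpoint_sq {E : Type*} [NormedAddCommGroup E] [InnerProductSpace ℝ E]
    (p q : E) : ⟪p, q⟫_ℝ ≤ ‖(1 / 2 : ℝ) • (p + q)‖ ^ 2 := by
  rw [norm_smul, mul_pow, norm_add_sq_real]
  have := norm_sub_sq_real p q
  norm_num
  nlinarith [sq_nonneg ‖p - q‖]

theorem exists_isometry_sum_norm_sub_sq_le {κ : Type*} [Fintype κ] (S : Finset (Fin 3))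
    {n y w : κ → EuclideanSpace ℝ (Fin 3)} {δ C : ℝ} (hδ : 0 ≤ δ)
    (hn : ∀ i, ‖n i‖ = 1) (hy : ∀ i, ‖y i‖ ≤ 1) (hw : ∀ i, ‖w i‖ ≤ 1)
    (hS : ∀ i, ∀ j ∉ S, n i j = 0)
    (h : ∀ i j, |⟪y i, w j⟫_ℝ - ⟪n i, n j⟫_ℝ| ≤ δ)
    (hC : ∀ b : EuclideanSpace ℝ (Fin 3), ∑ j ∈ S, b j ^ 2 ≤ C * ∑ i, ⟪n i, b⟫_ℝ ^ 2) :
    ∃ O : EuclideanSpace ℝ (Fin 3) ≃ₗᵢ[ℝ] EuclideanSpace ℝ (Fin 3),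
      ∑ i, ‖n i - O (y i)‖ ^ 2 ≤ 4 * (S.card * (δ * Fintype.card κ)) ∧
      ∑ i, ‖n i - O (y i)‖ ^ 2 ≤
        4 * (S.card * (δ * Fintype.card κ / 2 * (1 + δ * Fintype.card κ * C))) := by
  obtain ⟨O, b, hO⟩ := exists_isometry_sum_inner_eq (ι := Fin 3) (by simp) n
    (fun i => (1 / 2 : ℝ) • (y i + w i))
  refine ⟨O, ?_⟩
  set η := δ * Fintype.card κ with hη
  set g : Fin 3 → ℝ := fun a => ∑ i, ⟪n i, b a⟫_ℝ ^ 2 with hg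
  set r : Fin 3 → ℝ := fun a => ∑ j ∈ S, b a j ^ 2 with hr
  have hgsum : ∑ a, g a = Fintype.card κ := by
    rw [hg, Finset.sum_comm]
    have : ∀ i, ∑ a, ⟪n i, b a⟫_ℝ ^ 2 = 1 := fun i => by
      simpa [hn i] using b.sum_sq_norm_inner_left (n i)
    simp [this]
  have hrsum : ∑ a, r a = S.card := by
    rw [hr, Finset.sum_comm]
    have : ∀ j : Fin 3, ∑ a, b a j ^ 2 = 1 := fun j => by
      simpa [EuclideanSpace.inner_single_left] using
        b.sum_sq_norm_inner_left (EuclideanSpace.single j (1 : ℝ))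
    simp [this]
  have hbound : ∀ a, g a - r a * η ≤ ‖∑ i, ⟪n i, b a⟫_ℝ • (1 / 2 : ℝ) • (y i + w i)‖ ∧
      g a - r a * (η / 2 * (1 + η * C)) ≤ ‖∑ i, ⟪n i, b a⟫_ℝ • (1 / 2 : ℝ) • (y i + w i)‖ := by
    intro a
    set v : EuclideanSpace ℝ (Fin 3) := ∑ i, ⟪n i, b a⟫_ℝ • n i with hv
    refine singular_value_lower_bound (q := ‖v‖ ^ 2)
      (norm_nonneg _) (Finset.sum_nonneg fun _ _ => sq_nonneg _) ?_ (by positivity) ?_ ?_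
      (hC (b a)) (Finset.sum_nonneg fun _ _ => sq_nonneg _)
    · calc r a ≤ ∑ j, b a j ^ 2 :=
            Finset.sum_le_univ_sum_of_nonneg fun _ => sq_nonneg _
        _ = 1 := by
            have := EuclideanSpace.real_norm_sq_eq (b a)
            rw [← this, b.orthonormal.1 a, one_pow]
    · have hgv : g a = ∑ j ∈ S, b a j * v j := by
        have hvj : ∀ j ∉ S, v j = 0 := fun j hj => by simp [hv, hS _ j hj]
        calc g a = ⟪v, b a⟫_ℝ := by
              simp [hg, hv, sum_inner, inner_smul_left, sq]
          _ = ∑ j, b a j * v j := by simp [PiLp.inner_apply]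
          _ = _ := (Finset.sum_subset (Finset.subset_univ S)
              fun j _ hj => by rw [hvj j hj, mul_zero]).symm
      rw [hgv]
      refine (Finset.sum_mul_sq_le_sq_mul_sq S _ _).trans ?_
      refine mul_le_mul_of_nonneg_left ?_ (Finset.sum_nonneg fun _ _ => sq_nonneg _)
      rw [EuclideanSpace.real_norm_sq_eq]
      exact Finset.sum_le_univ_sum_of_nonneg fun _ => sq_nonneg _
    · refine (inner_sum_smul_lower_bound hδ h fun i => ⟪n i, b a⟫_ℝ).trans ?_
      refine (inner_le_norm_midpoint_sq _ _).trans_eq ?_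
      rw [← Finset.sum_add_distrib, Finset.smul_sum]
      congr 2
      exact Finset.sum_congr rfl fun i _ => by rw [← smul_add, smul_comm]
  have hdist : ∑ i, ‖n i - O (y i)‖ ^ 2 ≤
      4 * (Fintype.card κ - ∑ i, ⟪n i, O ((1 / 2 : ℝ) • (y i + w i))⟫_ℝ) := by
    have : (Fintype.card κ : ℝ) = ∑ _i : κ, (1 : ℝ) := by simp
    rw [this, ← Finset.sum_sub_distrib, Finset.mul_sum]
    refine Finset.sum_le_sum fun i _ => ?_
    have h1 := norm_sub_sq_real (n i) (O (y i))
    have h2 := norm_sub_sq_real (n i) (O (w i))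
    rw [hn i, O.norm_map] at h1 h2
    have h3 := hy i
    have h4 := hw i
    rw [map_smul, map_add, inner_smul_right, inner_add_right]
    nlinarith [sq_nonneg ‖n i - O (w i)‖, norm_nonneg (y i), norm_nonneg (w i)]
  have hl : ∀ l, (∀ a, g a - r a * l ≤ ‖∑ i, ⟪n i, b a⟫_ℝ • (1 / 2 : ℝ) • (y i + w i)‖) →
      ∑ i, ‖n i - O (y i)‖ ^ 2 ≤ 4 * (S.card * l) := by
    intro l hl
    have := Finset.sum_le_sum fun a (_ : a ∈ Finset.univ) => hl a
    rw [Finset.sum_sub_distrib, ← Finset.sum_mul, hgsum, hrsum] at this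
    linarith
  exact ⟨hl _ fun a => (hbound a).1, hl _ fun a => (hbound a).2⟩

theorem re_trace_mul_eq_bloch {A B : Matrix (Fin 2) (Fin 2) ℂ} (hA : A.IsHermitian)
    (hB : B.IsHermitian) :
    ((A * B).trace).re =
      1 / 2 * (A.trace.re * B.trace.re + ∑ j, bloch A j * bloch B j) := by
  have ha : ∀ i j, star (A j i) = A i j := fun i j => hA.apply i j
  have hb : ∀ i j, star (B j i) = B i j := fun i j => hB.apply i j
  have ha1 := ha 0 1
  have hb1 := hb 0 1
  have ha0 := congrArg Complex.im (ha 0 0)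
  have hb0 := congrArg Complex.im (hb 0 0)
  have ha2 := congrArg Complex.im (ha 1 1)
  have hb2 := congrArg Complex.im (hb 1 1)
  simp only [Complex.star_def, Complex.conj_im] at ha0 hb0 ha2 hb2
  simp only [bloch, pauli, Matrix.trace_fin_two, Fin.sum_univ_three, Matrix.mul_apply,
    Fin.sum_univ_two]
  rw [← ha1, ← hb1]
  simp
  have h1 : (A 0 0).im = 0 := by linarith
  have h2 : (B 0 0).im = 0 := by linarith
  have h3 : (A 1 1).im = 0 := by linarith
  have h4 : (B 1 1).im = 0 := by linarith
  rw [h1, h2, h3, h4]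
  ring

theorem sum_bloch_sq_le_trace_sq {A : Matrix (Fin 2) (Fin 2) ℂ} (hA : A.PosSemidef) :
    ∑ j, bloch A j ^ 2 ≤ A.trace.re ^ 2 := by
  have hdet := (Complex.le_def.1 hA.det_nonneg).1
  have ha : ∀ i j, star (A j i) = A i j := fun i j => hA.isHermitian.apply i j
  have ha1 := ha 0 1
  have ha0 := congrArg Complex.im (ha 0 0)
  have ha2 := congrArg Complex.im (ha 1 1)
  simp only [Complex.star_def, Complex.conj_im] at ha0 ha2
  have h1 : (A 0 0).im = 0 := by linarith
  have h3 : (A 1 1).im = 0 := by linarith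
  simp only [bloch, pauli, Matrix.trace_fin_two, Fin.sum_univ_three, Matrix.mul_apply,
    Fin.sum_univ_two]
  rw [Matrix.det_fin_two] at hdet
  rw [← ha1] at hdet ⊢
  simp [h1, h3] at hdet ⊢
  nlinarith

/-- The Bloch vector of a qubit operator as an element of Euclidean space. -/
noncomputable def blochVec (ρ : Matrix (Fin 2) (Fin 2) ℂ) : EuclideanSpace ℝ (Fin 3) :=
  WithLp.toLp 2 (bloch ρ)

theorem inner_blochVec (A B : Matrix (Fin 2) (Fin 2) ℂ) :
    ⟪blochVec A, blochVec B⟫_ℝ = ∑ j, bloch A j * bloch B j := by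
  simp [blochVec, PiLp.inner_apply, mul_comm]

theorem re_trace_mul_eq_inner {A B : Matrix (Fin 2) (Fin 2) ℂ} (hA : A.IsHermitian)
    (hB : B.IsHermitian) :
    ((A * B).trace).re =
      1 / 2 * (A.trace.re * B.trace.re + ⟪blochVec A, blochVec B⟫_ℝ) := by
  rw [re_trace_mul_eq_bloch hA hB, inner_blochVec]

theorem norm_blochVec_le {A : Matrix (Fin 2) (Fin 2) ℂ} (hA : A.PosSemidef) :
    ‖blochVec A‖ ≤ A.trace.re := by
  refine abs_le_of_sq_le_sq' ?_ (Complex.le_def.1 hA.trace_nonneg).1 |>.2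
  rw [EuclideanSpace.real_norm_sq_eq]
  exact sum_bloch_sq_le_trace_sq hA

theorem norm_blochVec_of_isPureState {A : Matrix (Fin 2) (Fin 2) ℂ} (hA : IsPureState A) :
    ‖blochVec A‖ = 1 := by
  obtain ⟨h1, h2, h3⟩ := hA
  have := re_trace_mul_eq_inner h1 h1
  rw [h2, h3, real_inner_self_eq_norm_sq] at this
  have hsq : ‖blochVec A‖ ^ 2 = 1 := by norm_num at this; linarith
  exact (pow_eq_one_iff_of_nonneg (norm_nonneg _) two_ne_zero).1 hsq

theorem blochVec_add (A B : Matrix (Fin 2) (Fin 2) ℂ) :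
    blochVec (A + B) = blochVec A + blochVec B := by
  ext j; simp [blochVec, bloch, add_mul]

theorem blochVec_one : blochVec 1 = 0 := by
  ext j; fin_cases j <;> simp [blochVec, bloch, pauli, Matrix.trace_fin_two]

/-- Constraints on the effect `M` and the preparations `A`, `B` when `(M, 1 - M)` is a qubit
POVM that discriminates `A` from `B` with errors at most `ε`. -/
theorem qubit_discrimination_bounds {A B M M' : Matrix (Fin 2) (Fin 2) ℂ} {ε : ℝ}
    (hε0 : 0 ≤ ε) (hε : ε ≤ 1 / 3) (hA : IsDensityMatrix A) (hB : IsDensityMatrix B)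
    (hM : M.PosSemidef) (hM' : M'.PosSemidef) (hMM : M + M' = 1)
    (hAM : 1 - ε ≤ ((A * M).trace).re) (hBM : ((B * M).trace).re ≤ ε) :
    M.trace.re ≤ 1 + ε ∧ ‖blochVec M‖ ≤ 1 ∧
      1 - 4 * (ε * (1 - 2 * ε) / (1 - ε) ^ 2) ≤ ‖blochVec A‖ ^ 2 := by
  have htr : M.trace.re + M'.trace.re = 2 := by
    have := congrArg (fun X => (Matrix.trace X).re) hMM
    simpa [Matrix.trace_add] using this
  have hvec : blochVec M' = -blochVec M := by
    rw [eq_neg_iff_add_eq_zero, add_comm, ← blochVec_add, hMM, blochVec_one]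
  have h1 := norm_blochVec_le hM
  have h2 := norm_blochVec_le hM'
  rw [hvec, norm_neg] at h2
  rw [re_trace_mul_eq_inner hA.1.isHermitian hM.isHermitian, hA.2] at hAM
  rw [re_trace_mul_eq_inner hB.1.isHermitian hM.isHermitian, hB.2] at hBM
  have hB1 := norm_blochVec_le hB.1
  rw [hB.2] at hB1
  simp only [Complex.one_re, one_mul] at hAM hBM hB1
  have hAi := real_inner_le_norm (blochVec A) (blochVec M)
  have hBi := neg_le_of_abs_le (abs_real_inner_le_norm (blochVec B) (blochVec M))
  have hBn : ‖blochVec B‖ * ‖blochVec M‖ ≤ ‖blochVec M‖ :=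
    mul_le_of_le_one_left (norm_nonneg _) hB1
  have ht : M.trace.re ≤ 1 + ε := by linarith
  refine ⟨ht, by linarith, ?_⟩
  have hpos : 0 < 1 - ε := by linarith
  have hAM' : (1 - 3 * ε) / (1 - ε) ≤ ‖blochVec A‖ := by
    rw [div_le_iff₀ hpos]
    have h3 : ‖blochVec A‖ * ‖blochVec M‖ ≤ ‖blochVec A‖ * (2 - M.trace.re) := by
      gcongr; linarith
    by_contra! hlt
    have h4 : ‖blochVec A‖ < 1 := by nlinarith
    nlinarith
  calc 1 - 4 * (ε * (1 - 2 * ε) / (1 - ε) ^ 2) = ((1 - 3 * ε) / (1 - ε)) ^ 2 := by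
        field_simp; ring
    _ ≤ ‖blochVec A‖ ^ 2 := by
        have : 0 ≤ (1 - 3 * ε) / (1 - ε) := div_nonneg (by linarith) hpos.le
        gcongr

theorem exists_unit_fixed_vector {A B : Matrix (Fin 2) (Fin 2) ℂ} (hAA : A * A = 1)
    (hBB : B * B = 1) (hAB : A * B = -(B * A)) :
    ∃ ψ : Fin 2 → ℂ, A *ᵥ ψ = ψ ∧ star ψ ⬝ᵥ ψ = 1 := by
  have hA : 1 + A ≠ 0 := by
    intro h
    have hA1 : A = -1 := (neg_eq_of_add_eq_zero_right h).symm
    have hB : B = -B := by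
      have := hAB
      rw [hA1] at this
      simp only [neg_mul, one_mul, mul_neg, mul_one, neg_neg] at this
      exact this.symm
    have hB0 : B = 0 := by
      ext i j
      exact self_eq_neg.1 (congrFun (congrFun hB i) j)
    rw [hB0] at hBB
    simp at hBB
  obtain ⟨v, hv⟩ : ∃ v, (1 + A) *ᵥ v ≠ 0 := by
    by_contra! h
    exact hA (Matrix.ext_of_mulVec_single fun i => by rw [h, Matrix.zero_mulVec])
  set φ := (1 + A) *ᵥ v with hφ
  have hAφ : A *ᵥ φ = φ := by
    rw [hφ, Matrix.mulVec_mulVec, mul_add, hAA, mul_one, add_comm]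
  set r : ℝ := ∑ i, ‖φ i‖ ^ 2 with hr
  have hφr : star φ ⬝ᵥ φ = (r : ℂ) := by
    simp [hr, dotProduct, ← Complex.conj_mul']
  have hr0 : 0 < r := by
    refine lt_of_le_of_ne (Finset.sum_nonneg fun _ _ => sq_nonneg _) fun h => hv ?_
    rw [← h, Complex.ofReal_zero] at hφr
    exact dotProduct_star_self_eq_zero.1 hφr
  refine ⟨(((√r)⁻¹ : ℝ) : ℂ) • φ, by rw [Matrix.mulVec_smul, hAφ], ?_⟩
  rw [star_smul, smul_dotProduct, dotProduct_smul, hφr]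
  simp only [Complex.star_def, Complex.conj_ofReal, smul_eq_mul]
  norm_cast
  have := Real.mul_self_sqrt hr0.le
  field_simp
  linarith

theorem exists_unitary_conj_pauli {A B : Matrix (Fin 2) (Fin 2) ℂ} (hA : A.IsHermitian)
    (hB : B.IsHermitian) (hAA : A * A = 1) (hBB : B * B = 1) (hAB : A * B = -(B * A)) :
    ∃ U ∈ Matrix.unitaryGroup (Fin 2) ℂ,
      U * pauli 2 * Uᴴ = A ∧ U * pauli 0 * Uᴴ = B := by
  obtain ⟨ψ, hAψ, hψ⟩ := exists_unit_fixed_vector hAA hBB hAB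
  set χ := B *ᵥ ψ with hχ
  have hBχ : B *ᵥ χ = ψ := by rw [hχ, Matrix.mulVec_mulVec, hBB, Matrix.one_mulVec]
  have hAχ : A *ᵥ χ = -χ := by
    rw [hχ, Matrix.mulVec_mulVec, hAB, Matrix.neg_mulVec, ← Matrix.mulVec_mulVec, hAψ]
  have hherm : ∀ {C : Matrix (Fin 2) (Fin 2) ℂ}, C.IsHermitian → ∀ u v : Fin 2 → ℂ,
      star (C *ᵥ u) ⬝ᵥ v = star u ⬝ᵥ (C *ᵥ v) := by
    intro C hC u v
    rw [Matrix.star_mulVec, hC.eq, Matrix.dotProduct_mulVec]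
  have hχχ : star χ ⬝ᵥ χ = 1 := by
    conv_lhs => rw [hχ, hherm hB, ← hχ, hBχ]
    exact hψ
  have hψχ : star ψ ⬝ᵥ χ = 0 := by
    have h := hherm hA ψ χ
    rw [hAψ, hAχ, dotProduct_neg] at h
    exact self_eq_neg.1 h
  have hχψ : star χ ⬝ᵥ ψ = 0 := by
    rw [hχ, hherm hB]
    exact hψχ
  set U : Matrix (Fin 2) (Fin 2) ℂ := !![ψ 0, χ 0; ψ 1, χ 1] with hU
  have hUU : Uᴴ * U = 1 := by
    simp only [dotProduct, Fin.sum_univ_two, Pi.star_apply] at hψ hχχ hψχ hχψ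
    ext i j
    fin_cases i <;> fin_cases j <;>
      simpa [hU, Matrix.mul_apply, Fin.sum_univ_two] using by assumption
  have hUU' : U * Uᴴ = 1 := mul_eq_one_comm.1 hUU
  have hz : U * pauli 2 = A * U := by
    have h0 := congrFun hAψ
    have h1 := congrFun hAχ
    simp only [Matrix.mulVec, dotProduct, Fin.sum_univ_two, Pi.neg_apply] at h0 h1
    ext i j
    fin_cases j <;> fin_cases i <;>
      simp [hU, pauli, Matrix.mul_apply, Fin.sum_univ_two, h0, h1]
  have hx : U * pauli 0 = B * U := by
    have h0 := congrFun hχ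
    have h1 := congrFun hBχ
    simp only [Matrix.mulVec, dotProduct, Fin.sum_univ_two] at h0 h1
    ext i j
    fin_cases j <;> fin_cases i <;>
      simp [hU, pauli, Matrix.mul_apply, Fin.sum_univ_two] <;>
      first | exact h0 _ | exact (h1 _).symm
  exact ⟨U, Matrix.mem_unitaryGroup_iff.2 hUU', by rw [hz, mul_assoc, hUU', mul_one],
    by rw [hx, mul_assoc, hUU', mul_one]⟩

/-- The traceless Hermitian matrix `v · σ`. -/
noncomputable def pauliVec (v : EuclideanSpace ℝ (Fin 3)) : Matrix (Fin 2) (Fin 2) ℂ :=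
  !![(v 2 : ℂ), v 0 - v 1 * Complex.I; v 0 + v 1 * Complex.I, -v 2]

theorem pauliVec_isHermitian (v : EuclideanSpace ℝ (Fin 3)) : (pauliVec v).IsHermitian := by
  ext i j
  fin_cases i <;> fin_cases j <;> simp [pauliVec, sub_eq_add_neg]

theorem pauliVec_mul_self {v : EuclideanSpace ℝ (Fin 3)} (hv : ‖v‖ = 1) :
    pauliVec v * pauliVec v = 1 := by
  have h : v 0 ^ 2 + v 1 ^ 2 + v 2 ^ 2 = 1 := by
    rw [← Fin.sum_univ_three (fun i => v i ^ 2), ← EuclideanSpace.real_norm_sq_eq, hv, one_pow]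
  have hc : (v 0 : ℂ) ^ 2 + (v 1 : ℂ) ^ 2 + (v 2 : ℂ) ^ 2 = 1 := by
    have := congrArg Complex.ofReal h
    push_cast at this
    exact this
  ext i j
  fin_cases i <;> fin_cases j <;> simp [pauliVec, Matrix.mul_apply, Fin.sum_univ_two]
  · linear_combination hc - (v 1 : ℂ) ^ 2 * Complex.I_sq
  · ring
  · ring
  · linear_combination hc - (v 1 : ℂ) ^ 2 * Complex.I_sq

theorem pauliVec_anticomm {u v : EuclideanSpace ℝ (Fin 3)} (huv : ⟪u, v⟫_ℝ = 0) :
    pauliVec u * pauliVec v = -(pauliVec v * pauliVec u) := by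
  have h : u 0 * v 0 + u 1 * v 1 + u 2 * v 2 = 0 := by
    rw [← huv]; simp [PiLp.inner_apply, Fin.sum_univ_three]; ring
  have hc : (u 0 : ℂ) * v 0 + u 1 * v 1 + u 2 * v 2 = 0 := by
    have := congrArg Complex.ofReal h
    push_cast at this
    exact this
  ext i j
  fin_cases i <;> fin_cases j <;> simp [pauliVec, Matrix.mul_apply, Fin.sum_univ_two]
  · linear_combination 2 * hc - 2 * (u 1 * v 1 : ℂ) * Complex.I_sq
  · ring
  · ring
  · linear_combination 2 * hc - 2 * (u 1 * v 1 : ℂ) * Complex.I_sq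

theorem blochVec_pauliVec (v : EuclideanSpace ℝ (Fin 3)) :
    blochVec (pauliVec v) = (2 : ℝ) • v := by
  ext j
  fin_cases j <;> simp [blochVec, bloch, pauli, pauliVec, Matrix.trace_fin_two] <;> ring

theorem blochVec_smul (r : ℝ) (A : Matrix (Fin 2) (Fin 2) ℂ) :
    blochVec ((r : ℂ) • A) = r • blochVec A := by
  ext j; simp [blochVec, bloch, Matrix.trace_smul]

theorem eq_sum_bloch_smul_pauli {A : Matrix (Fin 2) (Fin 2) ℂ} (hA : A.IsHermitian) :
    A = ((1 / 2 : ℝ) : ℂ) • ((A.trace.re : ℂ) • 1 + ((bloch A 0 : ℝ) : ℂ) • pauli 0 +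
      ((bloch A 1 : ℝ) : ℂ) • pauli 1 + ((bloch A 2 : ℝ) : ℂ) • pauli 2) := by
  have ha : ∀ i j, star (A j i) = A i j := fun i j => hA.apply i j
  have ha1 := ha 0 1
  have ha0 := congrArg Complex.im (ha 0 0)
  have ha2 := congrArg Complex.im (ha 1 1)
  simp only [Complex.star_def, Complex.conj_im] at ha0 ha2
  have h1 : (A 0 0).im = 0 := by linarith
  have h3 : (A 1 1).im = 0 := by linarith
  ext i j
  fin_cases i <;> fin_cases j <;>
    simp [bloch, pauli, Matrix.trace_fin_two, Matrix.mul_apply, Fin.sum_univ_two] <;>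
    (try rw [← ha1]) <;> (apply Complex.ext <;> simp [h1, h3] <;> ring)

theorem bloch_transpose (A : Matrix (Fin 2) (Fin 2) ℂ) (j : Fin 3) :
    bloch Aᵀ j = (if j = 1 then -1 else 1) * bloch A j := by
  fin_cases j <;>
    simp [bloch, pauli, Matrix.trace_fin_two, Matrix.mul_apply, Fin.sum_univ_two] <;> ring

theorem exists_sign_pauliVec_mul {a b d : EuclideanSpace ℝ (Fin 3)} (ha : ‖a‖ = 1)
    (hb : ‖b‖ = 1) (hd : ‖d‖ = 1) (hab : ⟪a, b⟫_ℝ = 0) (had : ⟪a, d⟫_ℝ = 0)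
    (hbd : ⟪b, d⟫_ℝ = 0) :
    ∃ s : ℝ, (s = 1 ∨ s = -1) ∧
      Complex.I • (pauliVec b * pauliVec a) = ((s : ℝ) : ℂ) • pauliVec d := by
  have hnorm : ∀ {v : EuclideanSpace ℝ (Fin 3)}, ‖v‖ = 1 →
      v 0 ^ 2 + v 1 ^ 2 + v 2 ^ 2 = 1 := fun {v} hv => by
    rw [← Fin.sum_univ_three (fun i => v i ^ 2), ← EuclideanSpace.real_norm_sq_eq, hv, one_pow]
  have hinner : ∀ {u v : EuclideanSpace ℝ (Fin 3)}, ⟪u, v⟫_ℝ = 0 →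
      u 0 * v 0 + u 1 * v 1 + u 2 * v 2 = 0 := fun {u v} huv => by
    rw [← huv]; simp [PiLp.inner_apply, Fin.sum_univ_three]; ring
  replace ha := hnorm ha
  replace hb := hnorm hb
  replace hd := hnorm hd
  replace hab := hinner hab
  replace had := hinner had
  replace hbd := hinner hbd
  obtain ⟨c0, h0⟩ : ∃ c, c = a 1 * b 2 - a 2 * b 1 := ⟨_, rfl⟩
  obtain ⟨c1, h1⟩ : ∃ c, c = a 2 * b 0 - a 0 * b 2 := ⟨_, rfl⟩
  obtain ⟨c2, h2⟩ : ∃ c, c = a 0 * b 1 - a 1 * b 0 := ⟨_, rfl⟩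
  have hcc : c0 ^ 2 + c1 ^ 2 + c2 ^ 2 = 1 := by
    rw [h0, h1, h2]
    linear_combination (b 0 ^ 2 + b 1 ^ 2 + b 2 ^ 2) * ha + hb -
      (a 0 * b 0 + a 1 * b 1 + a 2 * b 2) * hab
  have e0 : d 1 * c2 - d 2 * c1 = 0 := by
    rw [h1, h2]; linear_combination a 0 * hbd - b 0 * had
  have e1 : d 2 * c0 - d 0 * c2 = 0 := by
    rw [h0, h2]; linear_combination a 1 * hbd - b 1 * had
  have e2 : d 0 * c1 - d 1 * c0 = 0 := by
    rw [h0, h1]; linear_combination a 2 * hbd - b 2 * had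
  obtain ⟨s, hs⟩ : ∃ s, s = d 0 * c0 + d 1 * c1 + d 2 * c2 := ⟨_, rfl⟩
  have k0 : c0 = s * d 0 := by rw [hs]; linear_combination -c0 * hd + d 2 * e1 - d 1 * e2
  have k1 : c1 = s * d 1 := by rw [hs]; linear_combination -c1 * hd - d 2 * e0 + d 0 * e2
  have k2 : c2 = s * d 2 := by rw [hs]; linear_combination -c2 * hd + d 1 * e0 - d 0 * e1
  have hs2 : s ^ 2 = 1 := by
    rw [k0, k1, k2] at hcc
    linear_combination hcc - s ^ 2 * hd
  refine ⟨s, by simpa using hs2, ?_⟩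
  have q0 : (a 1 : ℂ) * b 2 - a 2 * b 1 = s * d 0 := by exact_mod_cast h0 ▸ k0
  have q1 : (a 2 : ℂ) * b 0 - a 0 * b 2 = s * d 1 := by exact_mod_cast h1 ▸ k1
  have q2 : (a 0 : ℂ) * b 1 - a 1 * b 0 = s * d 2 := by exact_mod_cast h2 ▸ k2
  have q : (a 0 : ℂ) * b 0 + a 1 * b 1 + a 2 * b 2 = 0 := by
    have := congrArg Complex.ofReal hab
    push_cast at this
    exact this
  have hI := Complex.I_sq
  ext i j
  fin_cases i <;> fin_cases j <;> simp [pauliVec]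
  · linear_combination q2 + Complex.I * q + (-(a 0 * b 1 - a 1 * b 0) - a 1 * b 1 * Complex.I) * hI
  · linear_combination q0 - Complex.I * q1 - (a 1 * b 2 - a 2 * b 1) * hI
  · linear_combination q0 + Complex.I * q1 - (a 1 * b 2 - a 2 * b 1) * hI
  · linear_combination -q2 + Complex.I * q + (a 0 * b 1 - a 1 * b 0 - a 1 * b 1 * Complex.I) * hI

theorem blochVec_conj_of_conj_pauli {O : EuclideanSpace ℝ (Fin 3) ≃ₗᵢ[ℝ] EuclideanSpace ℝ (Fin 3)}
    {U A : Matrix (Fin 2) (Fin 2) ℂ} {s : ℝ} (hU : U * Uᴴ = 1) (hA : A.IsHermitian)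
    (h0 : U * pauli 0 * Uᴴ = pauliVec (O (EuclideanSpace.single 0 1)))
    (h1 : U * pauli 1 * Uᴴ = ((s : ℝ) : ℂ) • pauliVec (O (EuclideanSpace.single 1 1)))
    (h2 : U * pauli 2 * Uᴴ = pauliVec (O (EuclideanSpace.single 2 1))) :
    blochVec (U * A * Uᴴ) = O (bloch A 0 • EuclideanSpace.single 0 1 +
      (s * bloch A 1) • EuclideanSpace.single 1 1 + bloch A 2 • EuclideanSpace.single 2 1) := by
  conv_lhs => rw [eq_sum_bloch_smul_pauli hA]
  simp only [mul_add, add_mul, Matrix.mul_smul, Matrix.smul_mul, mul_one, hU, h0, h1, h2,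
    blochVec_add, blochVec_smul, blochVec_one, blochVec_pauliVec, smul_zero, map_add,
    LinearIsometryEquiv.map_smul, smul_add, zero_add]
  simp only [smul_smul]
  congr 1
  · congr 1 <;> congr 1 <;> ring
  · congr 1; ring

theorem exists_unitary_blochVec
    (O : EuclideanSpace ℝ (Fin 3) ≃ₗᵢ[ℝ] EuclideanSpace ℝ (Fin 3)) :
    ∃ U ∈ Matrix.unitaryGroup (Fin 2) ℂ,
      (∀ A : Matrix (Fin 2) (Fin 2) ℂ, A.IsHermitian →
        blochVec (U * A * Uᴴ) = O (blochVec A)) ∨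
      (∀ A : Matrix (Fin 2) (Fin 2) ℂ, A.IsHermitian →
        blochVec (U * Aᵀ * Uᴴ) = O (blochVec A)) := by
  have hn : ∀ i, ‖O (EuclideanSpace.single i 1)‖ = 1 := fun i => by simp
  have hi : ∀ {i j}, i ≠ j →
      ⟪O (EuclideanSpace.single i 1), O (EuclideanSpace.single j 1)⟫_ℝ = 0 := fun {i j} hij => by
    rw [LinearIsometryEquiv.inner_map_map]
    simp [EuclideanSpace.inner_single_left, hij]
  obtain ⟨U, hU, h2, h0⟩ := exists_unitary_conj_pauli (pauliVec_isHermitian _)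
    (pauliVec_isHermitian _) (pauliVec_mul_self (hn 2)) (pauliVec_mul_self (hn 0))
    (pauliVec_anticomm (hi (by decide : (2 : Fin 3) ≠ 0)))
  obtain ⟨s, hs, hs'⟩ := exists_sign_pauliVec_mul (hn 2) (hn 0) (hn 1) (hi (by decide))
    (hi (by decide)) (hi (by decide))
  have hUU' : U * Uᴴ = 1 := Matrix.mem_unitaryGroup_iff.1 hU
  have hUU : Uᴴ * U = 1 := Matrix.mem_unitaryGroup_iff'.1 hU
  have hy : pauli 1 = Complex.I • (pauli 0 * pauli 2) := by
    ext i j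
    fin_cases i <;> fin_cases j <;> simp [pauli]
  have h1 : U * pauli 1 * Uᴴ = ((s : ℝ) : ℂ) • pauliVec (O (EuclideanSpace.single 1 1)) := by
    rw [← hs', ← h0, ← h2, hy, Matrix.mul_smul, Matrix.smul_mul]
    congr 1
    calc U * (pauli 0 * pauli 2) * Uᴴ = U * pauli 0 * 1 * pauli 2 * Uᴴ := by
          simp only [mul_one, mul_assoc]
      _ = _ := by rw [← hUU]; simp only [mul_assoc]
  have key : ∀ v : EuclideanSpace ℝ (Fin 3), v = v 0 • EuclideanSpace.single 0 1 +
      v 1 • EuclideanSpace.single 1 1 + v 2 • EuclideanSpace.single 2 1 := fun v => by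
    ext i
    fin_cases i <;> simp
  refine ⟨U, hU, ?_⟩
  rcases hs with rfl | rfl
  · refine Or.inl fun A hA => ?_
    rw [blochVec_conj_of_conj_pauli hUU' hA h0 h1 h2, one_mul]
    exact congrArg O (key (blochVec A)).symm
  · refine Or.inr fun A hA => ?_
    rw [blochVec_conj_of_conj_pauli hUU' hA.transpose h0 h1 h2, bloch_transpose,
      bloch_transpose, bloch_transpose]
    simp only [Fin.isValue, zero_ne_one, if_false, if_true, one_mul, neg_mul, neg_neg,
      (by decide : (2 : Fin 3) ≠ 1)]
    exact congrArg O (key (blochVec A)).symm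

theorem sum_sq_le_opNormR_sq_mul {m k : ℕ} {L : Matrix (Fin m) (Fin k) ℝ}
    {K : Matrix (Fin k) (Fin m) ℝ} (hKL : K * L = 1) (v : Fin k → ℝ) :
    ∑ j, v j ^ 2 ≤ opNormR K ^ 2 * ∑ i, (L *ᵥ v) i ^ 2 := by
  have h := (LinearMap.toContinuousLinearMap (Matrix.toEuclideanLin K)).le_opNorm
    (WithLp.toLp 2 (L *ᵥ v))
  have h' : LinearMap.toContinuousLinearMap (Matrix.toEuclideanLin K) (WithLp.toLp 2 (L *ᵥ v)) =
      WithLp.toLp 2 v := by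
    simp [Matrix.toLpLin_apply, Matrix.mulVec_mulVec, hKL]
  rw [h'] at h
  have h2 := pow_le_pow_left₀ (norm_nonneg _) h 2
  rw [mul_pow, EuclideanSpace.real_norm_sq_eq, EuclideanSpace.real_norm_sq_eq] at h2
  exact h2

theorem Fm_sq {m : ℕ} (hm : 2 ≤ m) {ε : ℝ} (hε : 0 ≤ ε) :
    Fm m ε ^ 2 = 4 * ((m : ℝ) * (m - 1) * ε * (1 + √ε) ^ 2 + 4 * m * ε ^ 2) := by
  have hm' : (2 : ℝ) ≤ m := by exact_mod_cast hm
  have h1 : (0 : ℝ) < m - 1 := by linarith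
  have hs := Real.sq_sqrt hε
  have hs0 := Real.sqrt_nonneg ε
  unfold Fm
  rw [Real.sq_sqrt (by positivity)]
  field_simp
  linear_combination -ε * ((m : ℝ) - 1) * hs

theorem le_Pm_sq {k m : ℕ} {c ε X : ℝ} (hk : k = 2 ∨ k = 3) (hkm : k ≤ m)
    (hC : (k : ℝ) ≤ c ^ 2 * m) (hc : 0 ≤ c) (hε0 : 0 ≤ ε) (hε : ε ≤ 1 / 3)
    (hX : X ≤ 4 * (k * (3 * ε * m)))
    (hX' : X ≤ 4 * (k * (3 * ε * m / 2 * (1 + 3 * ε * m * c ^ 2)))) :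
    X ≤ Pm k c (Fm m ε) ^ 2 := by
  have hF0 : 0 ≤ Fm m ε := Real.sqrt_nonneg _
  have hF2 := Fm_sq (by omega : 2 ≤ m) hε0
  have hk' : (k : ℝ) = 2 ∨ (k : ℝ) = 3 := by rcases hk with rfl | rfl <;> norm_num
  have hkm' : (k : ℝ) ≤ m := by exact_mod_cast hkm
  have hs := Real.sq_sqrt hε0
  have hs3 : √ε ^ 2 ≤ 1 / 3 := by rwa [hs]
  have hr1 : 1 ≤ √(k : ℝ) := Real.one_le_sqrt.2 (by rcases hk' with h | h <;> rw [h] <;> norm_num)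
  have hr0 : 0 ≤ √(k : ℝ) := Real.sqrt_nonneg _
  have hF := Real.sq_sqrt hF0
  have hf0 := Real.sqrt_nonneg (Fm m ε)
  have hrk : √(k : ℝ) ^ 2 = k := Real.sq_sqrt (Nat.cast_nonneg k)
  generalize Fm m ε = F at *
  have hcF : 0 ≤ c * F := mul_nonneg hc hF0
  unfold Pm
  split_ifs with hlt
  · have hpos : 0 < 1 - c ^ 2 * F := by
      rw [← hF, ← mul_pow, sub_pos]
      exact pow_lt_one₀ (mul_nonneg hc hf0) hlt two_ne_zero
    have hA : c * F ≤ c * F / √(1 - c ^ 2 * F) := by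
      refine le_div_self hcF (Real.sqrt_pos.2 hpos) (Real.sqrt_le_one.2 ?_)
      have : 0 ≤ c ^ 2 * F := by positivity
      linarith
    have hB : c * F ≤ √(√(k : ℝ) * F) := by
      calc c * F = c * √F * √F := by rw [mul_assoc, ← sq, hF]
        _ ≤ 1 * √F := by gcongr
        _ ≤ √(√(k : ℝ) * F) := by
          rw [one_mul]
          exact Real.sqrt_le_sqrt (le_mul_of_one_le_left hF0 hr1)
    have hP := le_min hA hB
    calc X ≤ 4 * (c ^ 2 * F ^ 2) := by
          rw [hF2]
          exact hX'.trans (procrustes_budget_small hk' hkm' hC (Real.sqrt_nonneg ε) hs3 hs.symm)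
      _ = (c * F + c * F) ^ 2 := by ring
      _ ≤ _ := by gcongr
  · have htr : √√(k : ℝ) ^ 2 = √(k : ℝ) := Real.sq_sqrt hr0
    have ht0 : 0 ≤ √√(k : ℝ) := Real.sqrt_nonneg _
    have hlarge := procrustes_budget_large hk' hkm' hC (Real.sqrt_nonneg ε) hs3 hs.symm hF0 hF2
      ht0 hr0 hrk htr
    rw [Real.sqrt_mul hr0]
    have h1 : F ≤ c * F * √F := by
      calc F = 1 * F := (one_mul F).symm
        _ ≤ c * √F * F := mul_le_mul_of_nonneg_right (not_lt.1 hlt) hF0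
        _ = c * F * √F := by ring
    calc X ≤ c ^ 2 * F ^ 2 + 2 * (√√(k : ℝ) * F) + √(k : ℝ) * F := hX.trans hlarge
      _ ≤ c ^ 2 * F ^ 2 + 2 * (√√(k : ℝ) * (c * F * √F)) + √(k : ℝ) * F := by gcongr
      _ = _ := by
        linear_combination -F * htr - √√(k : ℝ) ^ 2 * hF

theorem selftest_bloch_bounds {n : ℕ} {ε : ℝ} (hε0 : 0 ≤ ε) (hε : ε ≤ 1 / 3)
    {ρ ρt Mt : Fin n → Fin 2 → Matrix (Fin 2) (Fin 2) ℂ}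
    (hρ : ∀ x a, IsPureState (ρ x a)) (hρsum : ∀ x, ρ x 0 + ρ x 1 = 1)
    (hρt : ∀ x a, IsDensityMatrix (ρt x a)) (hMt : ∀ y b, (Mt y b).PosSemidef)
    (hMtsum : ∀ y, Mt y 0 + Mt y 1 = 1)
    (hstat : ∀ x y a b,
      |((ρt x a * Mt y b).trace).re - ((ρ x a * ρ y b).trace).re| ≤ ε) :
    (∀ x a, ‖blochVec (Mt x a)‖ ≤ 1 ∧
      1 - 4 * (ε * (1 - 2 * ε) / (1 - ε) ^ 2) ≤ ‖blochVec (ρt x a)‖ ^ 2) ∧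
    ∀ x y a b, |⟪blochVec (ρt x a), blochVec (Mt y b)⟫_ℝ -
      ⟪blochVec (ρ x a), blochVec (ρ y b)⟫_ℝ| ≤ 3 * ε := by
  have hρsum' : ∀ x a, ρ x (a + 1) = 1 - ρ x a := fun x a => by
    rw [← hρsum x]; fin_cases a <;> simp
  have hMsum' : ∀ x a, Mt x a + Mt x (a + 1) = 1 := fun x a => by
    rw [← hMtsum x]; fin_cases a <;> simp [add_comm]
  have hq : ∀ x a, (Mt x a).trace.re ≤ 1 + ε ∧ ‖blochVec (Mt x a)‖ ≤ 1 ∧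
      1 - 4 * (ε * (1 - 2 * ε) / (1 - ε) ^ 2) ≤ ‖blochVec (ρt x a)‖ ^ 2 := fun x a => by
    refine qubit_discrimination_bounds hε0 hε (hρt x a) (hρt x (a + 1)) (hMt x a)
      (hMt x (a + 1)) (hMsum' x a) ?_ ?_
    · have h := (abs_le.1 (hstat x x a a)).1
      rw [(hρ x a).2.1, (hρ x a).2.2, Complex.one_re] at h
      linarith
    · have h := (abs_le.1 (hstat x x (a + 1) a)).2
      rw [hρsum', sub_mul, one_mul, (hρ x a).2.1, sub_self, Matrix.trace_zero,
        Complex.zero_re] at h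
      linarith
  refine ⟨fun x a => (hq x a).2, fun x y a b => ?_⟩
  have htr : (Mt y b).trace.re + (Mt y (b + 1)).trace.re = 2 := by
    have := congrArg (fun X => (Matrix.trace X).re) (hMsum' y b)
    simpa [Matrix.trace_add] using this
  have h1 := (hq y b).1
  have h2 := (hq y (b + 1)).1
  have h := abs_le.1 (hstat x y a b)
  rw [re_trace_mul_eq_inner (hρt x a).1.isHermitian (hMt y b).isHermitian,
    re_trace_mul_eq_inner (hρ x a).1 (hρ y b).1, (hρt x a).2, (hρ x a).2.2, (hρ y b).2.2] at h
  simp only [Complex.one_re, one_mul] at h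
  rw [abs_le]
  constructor <;> linarith

theorem exists_isometry_sum_norm_sub_sq_le_Pm_sq {m k : ℕ} (hk : k = 2 ∨ k = 3) (hk3 : k ≤ 3)
    {ε : ℝ} (hε0 : 0 ≤ ε) (hε : ε ≤ 1 / 3) {n y w : Fin m → EuclideanSpace ℝ (Fin 3)}
    (hn : ∀ i, ‖n i‖ = 1) (hy : ∀ i, ‖y i‖ ≤ 1) (hw : ∀ i, ‖w i‖ ≤ 1)
    (h : ∀ i j, |⟪y i, w j⟫_ℝ - ⟪n i, n j⟫_ℝ| ≤ 3 * ε) {L : Matrix (Fin m) (Fin k) ℝ}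
    (hL : ∀ i j, L i j = n i (Fin.castLE hk3 j))
    (hzero : ∀ i (j : Fin 3), k ≤ (j : ℕ) → n i j = 0) (hfull : IsUnit (Lᵀ * L)) :
    ∃ O : EuclideanSpace ℝ (Fin 3) ≃ₗᵢ[ℝ] EuclideanSpace ℝ (Fin 3),
      ∑ i, ‖n i - O (y i)‖ ^ 2 ≤ Pm k (opNormR ((Lᵀ * L)⁻¹ * Lᵀ)) (Fm m ε) ^ 2 := by
  have hKL : (Lᵀ * L)⁻¹ * Lᵀ * L = 1 := by
    rw [Matrix.mul_assoc]
    exact Matrix.nonsing_inv_mul _ ((Matrix.isUnit_iff_isUnit_det _).1 hfull)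
  have hkm : k ≤ m := by
    have hinj : Function.Injective L.mulVecLin := fun u v huv => by
      have := congrArg (((Lᵀ * L)⁻¹ * Lᵀ) *ᵥ ·) huv
      simpa [Matrix.mulVec_mulVec, hKL] using this
    simpa using LinearMap.finrank_le_finrank_of_injective hinj
  set c := opNormR ((Lᵀ * L)⁻¹ * Lᵀ) with hc
  have hc0 : 0 ≤ c := norm_nonneg _
  let S : Finset (Fin 3) := Finset.univ.map (Fin.castLEEmb hk3)
  have hmem : ∀ j : Fin 3, j ∉ S → k ≤ (j : ℕ) := fun j hj => by
    by_contra! hlt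
    exact hj (Finset.mem_map.2 ⟨⟨j, hlt⟩, Finset.mem_univ _, rfl⟩)
  have hSsum : ∀ f : Fin 3 → ℝ, ∑ j ∈ S, f j = ∑ j : Fin k, f (Fin.castLE hk3 j) := fun f => by
    simp [S]
  have hScard : S.card = k := by simp [S]
  have hS : ∀ i, ∀ j ∉ S, n i j = 0 := fun i j hj => hzero i j (hmem j hj)
  have hinner : ∀ i (b : EuclideanSpace ℝ (Fin 3)),
      ⟪n i, b⟫_ℝ = (L *ᵥ fun j => b (Fin.castLE hk3 j)) i := fun i b => by
    simp only [Matrix.mulVec, dotProduct, hL, PiLp.inner_apply]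
    rw [← hSsum fun j => n i j * b j, Finset.sum_subset (Finset.subset_univ S)]
    · exact Finset.sum_congr rfl fun j _ => by simp [mul_comm]
    · intro j _ hj
      rw [hS i j hj, zero_mul]
  have hC : ∀ b : EuclideanSpace ℝ (Fin 3),
      ∑ j ∈ S, b j ^ 2 ≤ c ^ 2 * ∑ i, ⟪n i, b⟫_ℝ ^ 2 := fun b => by
    simp only [hinner]
    rw [hSsum fun j => b j ^ 2]
    exact sum_sq_le_opNormR_sq_mul hKL _
  have hkC : (k : ℝ) ≤ c ^ 2 * m := by
    have hj : ∀ j ∈ S, (1 : ℝ) ≤ c ^ 2 * ∑ i, n i j ^ 2 := fun j hj => by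
      have := hC (EuclideanSpace.single j 1)
      simp only [EuclideanSpace.inner_single_right, PiLp.single_apply] at this
      simpa [ite_pow, hj] using this
    calc (k : ℝ) = ∑ j ∈ S, (1 : ℝ) := by simp [hScard]
      _ ≤ ∑ j ∈ S, c ^ 2 * ∑ i, n i j ^ 2 := Finset.sum_le_sum hj
      _ ≤ ∑ j, c ^ 2 * ∑ i, n i j ^ 2 :=
          Finset.sum_le_sum_of_subset_of_nonneg (Finset.subset_univ S) fun _ _ _ => by positivity
      _ = c ^ 2 * ∑ i, ‖n i‖ ^ 2 := by
          rw [← Finset.mul_sum, Finset.sum_comm]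
          simp only [EuclideanSpace.real_norm_sq_eq]
      _ = c ^ 2 * m := by simp [hn]
  obtain ⟨O, h1, h2⟩ := exists_isometry_sum_norm_sub_sq_le S (by positivity) hn hy hw hS h hC
  rw [hScard, Fintype.card_fin] at h1 h2
  exact ⟨O, le_Pm_sq hk hkm hkC hc0 hε0 hε h1 h2⟩

theorem trace_conj_of_mem_unitaryGroup {U : Matrix (Fin 2) (Fin 2) ℂ}
    (hU : U ∈ Matrix.unitaryGroup (Fin 2) ℂ) (A : Matrix (Fin 2) (Fin 2) ℂ) :
    (U * A * Uᴴ).trace = A.trace := by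
  have h : Uᴴ * U = 1 := Matrix.mem_unitaryGroup_iff'.1 hU
  rw [Matrix.trace_mul_comm, ← mul_assoc, h, one_mul]

/-- Average fidelity in terms of the Procrustes error of the Bloch vectors. -/
theorem le_average_fidelity {m : ℕ} (hm : 1 ≤ m) {q P : ℝ}
    {ρ τ : Fin m → Matrix (Fin 2) (Fin 2) ℂ} (hρ : ∀ i, IsPureState (ρ i))
    (hτ : ∀ i, (τ i).IsHermitian) (hτ1 : ∀ i, (τ i).trace = 1)
    (hq : ∀ i, 1 - 4 * q ≤ ‖blochVec (τ i)‖ ^ 2)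
    (hP : ∑ i, ‖blochVec (ρ i) - blochVec (τ i)‖ ^ 2 ≤ P) :
    1 - q - P / (4 * m) ≤ 1 / (m : ℝ) * ∑ i, ((ρ i * τ i).trace).re := by
  have hm0 : (0 : ℝ) < m := by exact_mod_cast hm
  have hi : ∀ i, 1 - q - 1 / 4 * ‖blochVec (ρ i) - blochVec (τ i)‖ ^ 2 ≤
      ((ρ i * τ i).trace).re := fun i => by
    rw [re_trace_mul_eq_inner (hρ i).1 (hτ i), (hρ i).2.2, hτ1 i, norm_sub_sq_real,
      norm_blochVec_of_isPureState (hρ i)]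
    simp only [Complex.one_re]
    linarith [hq i]
  have hsum := Finset.sum_le_sum fun i (_ : i ∈ Finset.univ) => hi i
  rw [Finset.sum_sub_distrib, ← Finset.mul_sum, Finset.sum_const, Finset.card_univ,
    Fintype.card_fin, nsmul_eq_mul] at hsum
  rw [one_div, ← div_eq_inv_mul, le_div_iff₀ hm0]
  calc (1 - q - P / (4 * m)) * m = m * (1 - q) - 1 / 4 * P := by field_simp
    _ ≤ _ := by linarith

/-- Lemma 4: robust self-testing bound via the orthogonal Procrustes problem. -/
theorem robust_selftesting_procrustes (n m k : ℕ) (hm : 1 ≤ m)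
    (hk : k = 2 ∨ k = 3) (hk3 : k ≤ 3)
    (ε : ℝ) (hε0 : 0 ≤ ε) (hε : ε ≤ 1/3)
    (ρ ρt Mt : Fin n → Fin 2 → Matrix (Fin 2) (Fin 2) ℂ)
    (hρ : ∀ x a, IsPureState (ρ x a))
    (hρsum : ∀ x, ρ x 0 + ρ x 1 = 1)
    (hρt : ∀ x a, IsDensityMatrix (ρt x a))
    (hMt : ∀ y b, (Mt y b).PosSemidef)
    (hMtsum : ∀ y, Mt y 0 + Mt y 1 = 1)
    (hstat : ∀ x y a b,
      |((ρt x a * Mt y b).trace).re - ((ρ x a * ρ y b).trace).re| ≤ ε)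
    -- the selected subset of `m` target states, with experimental counterparts
    (sel : Fin m ↪ Fin n × Fin 2)
    -- `L` is the m×k matrix of (truncated) Bloch vectors of the selected states
    (L : Matrix (Fin m) (Fin k) ℝ)
    (hL : ∀ i (j : Fin k), L i j = bloch (ρ (sel i).1 (sel i).2) (Fin.castLE hk3 j))
    -- if `k = 2`, the remaining Bloch components of the selected states vanish
    (hzero : ∀ i (j : Fin 3), k ≤ (j : ℕ) → bloch (ρ (sel i).1 (sel i).2) j = 0)
    -- `L` has full column rank `k`, so that `LᵀL` is invertible
    (hfull : IsUnit (Lᵀ * L)) :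
    ∃ U : Matrix (Fin 2) (Fin 2) ℂ, U ∈ Matrix.unitaryGroup (Fin 2) ℂ ∧
      (1 - ε * (1 - 2 * ε) / (1 - ε)^2
          - (Pm k (opNormR ((Lᵀ * L)⁻¹ * Lᵀ)) (Fm m ε))^2 / (4 * (m : ℝ))
          ≤ (1 / (m : ℝ)) * ∑ i,
              ((ρ (sel i).1 (sel i).2 * (U * ρt (sel i).1 (sel i).2 * Uᴴ)).trace).re ∨
       1 - ε * (1 - 2 * ε) / (1 - ε)^2
          - (Pm k (opNormR ((Lᵀ * L)⁻¹ * Lᵀ)) (Fm m ε))^2 / (4 * (m : ℝ))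
          ≤ (1 / (m : ℝ)) * ∑ i,
              ((ρ (sel i).1 (sel i).2 * (U * (ρt (sel i).1 (sel i).2)ᵀ * Uᴴ)).trace).re) := by
  obtain ⟨hb, hgram⟩ := selftest_bloch_bounds hε0 hε hρ hρsum hρt hMt hMtsum hstat
  have hy : ∀ x a, ‖blochVec (ρt x a)‖ ≤ 1 := fun x a => by
    simpa [(hρt x a).2] using norm_blochVec_le (hρt x a).1
  obtain ⟨O, hO⟩ := exists_isometry_sum_norm_sub_sq_le_Pm_sq hk hk3 hε0 hε
    (n := fun i => blochVec (ρ (sel i).1 (sel i).2))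
    (y := fun i => blochVec (ρt (sel i).1 (sel i).2))
    (w := fun i => blochVec (Mt (sel i).1 (sel i).2))
    (fun i => norm_blochVec_of_isPureState (hρ _ _)) (fun i => hy _ _) (fun i => (hb _ _).1)
    (fun i j => hgram _ _ _ _) hL hzero hfull
  obtain ⟨U, hU, hUO | hUO⟩ := exists_unitary_blochVec O
  · refine ⟨U, hU, Or.inl (le_average_fidelity hm (fun i => hρ _ _) (fun i => ?_)
      (fun i => ?_) (fun i => ?_) ?_)⟩
    · exact Matrix.isHermitian_mul_mul_conjTranspose U (hρt _ _).1.isHermitian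
    · rw [trace_conj_of_mem_unitaryGroup hU, (hρt _ _).2]
    · rw [hUO _ (hρt _ _).1.isHermitian, LinearIsometryEquiv.norm_map]
      exact (hb _ _).2
    · simpa only [hUO _ (hρt _ _).1.isHermitian] using hO
  · refine ⟨U, hU, Or.inr (le_average_fidelity hm (fun i => hρ _ _) (fun i => ?_)
      (fun i => ?_) (fun i => ?_) ?_)⟩
    · exact Matrix.isHermitian_mul_mul_conjTranspose U (hρt _ _).1.isHermitian.transpose
    · rw [trace_conj_of_mem_unitaryGroup hU, Matrix.trace_transpose, (hρt _ _).2]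
    · rw [hUO _ (hρt _ _).1.isHermitian, LinearIsometryEquiv.norm_map]
      exact (hb _ _).2
    · simpa only [hUO _ (hρt _ _).1.isHermitian] using hO
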